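/- Let f : ℝⁿ → ℝ and c : ℝⁿ → ℝᵐ be continuous, let N be the set of local constrained minimizers with common objective value f*, and assume: (a) there exists a nonempty compact set N* of local constrained minimizers that is an isolated subset of N; (b) at least one point of N* lies in the closure of strict(F). Let {μ_k} be a strictly decreasing sequence of positive numbers with μ_k → 0. Then there exists a compact set S with N* ⊆ int(S) ∩ F such that, for all sufficiently large k, there exists a point y_k ∈ strict(F) ∩ int(S) at which B_{μ_k} attains its minimum over strict(F) ∩ S, i.e. B_{μ_k}(y_k) = min{ B_{μ_k}(x) : x ∈ strict(F) ∩ S }; in particular y_k is an unconstrained local minimizer of B_{μ_k}. -/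

import Mathlib

open Set Filter Topology

/-- Over a compact set, the logarithmic barrier function attains its minimum among the strictly
feasible points: such minimizers are the maximizers of `exp (-f / μ) * ∏ i, c i`, which is
continuous on the whole feasible set and vanishes where some constraint is active. -/
lemma exists_isMinOn_log_barrier {X ι : Type*} [TopologicalSpace X] [Fintype ι]
    {f : X → ℝ} {c : X → ι → ℝ} (hf : Continuous f) (hc : Continuous c)
    {S : Set X} (hS : IsCompact S) (hne : (S ∩ {x | ∀ i, 0 < c x i}).Nonempty)
    {μ : ℝ} (hμ : 0 < μ) :
    ∃ y ∈ S ∩ {x | ∀ i, 0 < c x i}, IsMinOn (fun x => f x - μ * ∑ i, Real.log (c x i))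
      (S ∩ {x | ∀ i, 0 < c x i}) y := by
  have hci : ∀ i, Continuous fun x => c x i := fun i => (continuous_apply i).comp hc
  obtain ⟨x₀, hx₀S, hx₀⟩ := hne
  have hclosed : IsClosed {x | ∀ i, 0 ≤ c x i} := by
    rw [ofPred_forall]
    exact isClosed_iInter fun i => isClosed_le continuous_const (hci i)
  have hcont : Continuous fun x => Real.exp (-f x / μ) * ∏ i, c x i :=
    (Real.continuous_exp.comp (hf.neg.div_const μ)).mul
      (continuous_finsetProd _ fun i _ => hci i)
  obtain ⟨y, ⟨hyS, hyF⟩, hymax⟩ := (hS.inter_right hclosed).exists_isMaxOn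
    ⟨x₀, hx₀S, fun i => (hx₀ i).le⟩ hcont.continuousOn
  have hpos : ∀ x, (∀ i, 0 < c x i) → 0 < Real.exp (-f x / μ) * ∏ i, c x i := fun x hx =>
    mul_pos (Real.exp_pos _) (Finset.prod_pos fun i _ => hx i)
  have hlog : ∀ x, (∀ i, 0 < c x i) →
      Real.log (Real.exp (-f x / μ) * ∏ i, c x i) = -f x / μ + ∑ i, Real.log (c x i) := by
    intro x hx
    rw [Real.log_mul (Real.exp_pos _).ne' (Finset.prod_pos fun i _ => hx i).ne', Real.log_exp,
      Real.log_prod fun i _ => (hx i).ne']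
  have hy : ∀ i, 0 < c y i := by
    intro i
    refine (hyF i).lt_of_ne' fun h0 => ?_
    have h := (hpos x₀ hx₀).trans_le (hymax ⟨hx₀S, fun i => (hx₀ i).le⟩)
    simp [Finset.prod_eq_zero (Finset.mem_univ i) h0] at h
  refine ⟨y, ⟨hyS, hy⟩, fun x hx => ?_⟩
  have h := Real.log_le_log (hpos x hx.2) (hymax ⟨hx.1, fun i => (hx.2 i).le⟩)
  rw [hlog x hx.2, hlog y hy] at h
  have h' := mul_le_mul_of_nonneg_left h hμ.le
  simp only [mul_add, mul_div_cancel₀ _ hμ.ne'] at h'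
  simp only [mem_ofPred_eq]
  linarith

/-- A continuous function exceeding `a` on a compact set exceeds it by a uniform margin. -/
lemma IsCompact.exists_forall_le_of_lt {X : Type*} [TopologicalSpace X] {T : Set X}
    (hT : IsCompact T) {f : X → ℝ} (hf : Continuous f) {a : ℝ} (h : ∀ x ∈ T, a < f x) :
    ∃ b, a < b ∧ ∀ x ∈ T, b ≤ f x := by
  rcases T.eq_empty_or_nonempty with rfl | hne
  · exact ⟨a + 1, by linarith, by simp⟩
  · obtain ⟨z, hz, hmin⟩ := hT.exists_isMinOn hne hf.continuousOn
    exact ⟨f z, h z hz, fun x hx => hmin hx⟩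

/-- An isolated compact set of local minimizers with common value `a` has a compact neighbourhood
on which every feasible point outside the set has value greater than `a`. -/
lemma exists_compact_forall_lt_of_isolated {X : Type*} [TopologicalSpace X]
    [LocallyCompactSpace X] [RegularSpace X] {f : X → ℝ} {F M E : Set X} {a : ℝ}
    (hM : IsCompact M) (hmin : ∀ x ∈ M, IsLocalMinOn f F x ∧ f x = a)
    (hE : IsOpen E) (hME : M ⊆ E)
    (hiso : ∀ x ∈ E, x ∈ F → IsLocalMinOn f F x → f x = a → x ∈ M) :
    ∃ S, IsCompact S ∧ M ⊆ interior S ∧ ∀ x ∈ S, x ∈ F → x ∉ M → a < f x := by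
  set W : Set X := interior {x | x ∈ F → a ≤ f x} with hW
  have hMW : M ⊆ W := by
    intro x hx
    obtain ⟨hloc, hval⟩ := hmin x hx
    rw [hW, mem_interior_iff_mem_nhds]
    filter_upwards [eventually_nhdsWithin_iff.1 hloc] with y hy hyF
    exact hval ▸ hy hyF
  obtain ⟨S, hS, hMS, hSW⟩ := exists_compact_between hM (hE.inter isOpen_interior)
    (subset_inter hME hMW)
  refine ⟨S, hS, hMS, fun x hxS hxF hxM => ?_⟩
  obtain ⟨hxE, hxW⟩ := hSW hxS
  refine (interior_subset hxW hxF).lt_of_ne' fun heq => hxM (hiso x hxE hxF ?_ heq)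
  refine eventually_nhdsWithin_iff.2 ?_
  filter_upwards [mem_interior_iff_mem_nhds.1 hxW] with y hy hyF
  exact heq ▸ hy hyF

/-- Existence of unconstrained minimizers of the logarithmic barrier function
`B_{μ_k}` near an isolated compact set `N*` of local constrained minimizers. -/
theorem barrier_minimizers_exist
    (n m : ℕ)
    (f : EuclideanSpace ℝ (Fin n) → ℝ)
    (c : EuclideanSpace ℝ (Fin n) → Fin m → ℝ)
    (hf : Continuous f) (hc : Continuous c)
    -- the feasible region and its strict interior
    (F strictF : Set (EuclideanSpace ℝ (Fin n)))
    (hF : F = {x | ∀ i, 0 ≤ c x i})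
    (hstrictF : strictF = {x | ∀ i, 0 < c x i})
    -- the set of local constrained minimizers with common objective value f*
    (fstar : ℝ)
    (N : Set (EuclideanSpace ℝ (Fin n)))
    (hN : N = {x | x ∈ F ∧ IsLocalMinOn f F x ∧ f x = fstar})
    -- (a) N* is a nonempty compact isolated subset of N
    (Nstar : Set (EuclideanSpace ℝ (Fin n)))
    (hsub : Nstar ⊆ N) (hNstarNe : Nstar.Nonempty) (hcpt : IsCompact Nstar)
    (hiso : ∃ E : Set (EuclideanSpace ℝ (Fin n)),
      IsOpen E ∧ Nstar ⊆ E ∧ closure E ∩ N = Nstar)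
    -- (b) at least one point of N* lies in the closure of strict(F)
    (hcl : ∃ x ∈ Nstar, x ∈ closure strictF)
    -- the barrier parameters: strictly decreasing positive sequence tending to 0
    (μ : ℕ → ℝ) (hμpos : ∀ k, 0 < μ k) (hμanti : StrictAnti μ)
    (hμ0 : Tendsto μ atTop (𝓝 0))
    -- the logarithmic barrier function
    (B : ℝ → EuclideanSpace ℝ (Fin n) → ℝ)
    (hB : B = fun μ x => f x - μ * ∑ i, Real.log (c x i)) :
    ∃ S : Set (EuclideanSpace ℝ (Fin n)), IsCompact S ∧
      Nstar ⊆ interior S ∩ F ∧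
      ∃ K : ℕ, ∀ k ≥ K, ∃ y : EuclideanSpace ℝ (Fin n),
        y ∈ strictF ∩ interior S ∧
        (∀ x ∈ strictF ∩ S, B (μ k) y ≤ B (μ k) x) ∧
        IsLocalMin (B (μ k)) y := by
  subst hF hstrictF hN hB
  obtain ⟨E, hE, hNE, hEN⟩ := hiso
  obtain ⟨S, hS, hNS, hlt⟩ := exists_compact_forall_lt_of_isolated
    (F := {x | ∀ i, 0 ≤ c x i}) hcpt (fun x hx => (hsub hx).2) hE hNE
    fun x hxE hxF hloc hval => hEN ▸ ⟨subset_closure hxE, hxF, hloc, hval⟩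
  refine ⟨S, hS, fun x hx => ⟨hNS hx, (hsub hx).1⟩, ?_⟩
  have hci : ∀ i, Continuous fun x => c x i := fun i => (continuous_apply i).comp hc
  have hclosed : IsClosed {x | ∀ i, 0 ≤ c x i} := by
    rw [ofPred_forall]
    exact isClosed_iInter fun i => isClosed_le continuous_const (hci i)
  have hopen : IsOpen {x | ∀ i, 0 < c x i} := by
    rw [ofPred_forall]
    exact isOpen_iInter_of_finite fun i => isOpen_lt continuous_const (hci i)
  obtain ⟨b, hb, hbf⟩ := ((hS.diff isOpen_interior).inter_right hclosed).exists_forall_le_of_lt hf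
    fun x hx => hlt x hx.1.1 hx.2 fun hxN => hx.1.2 (hNS hxN)
  -- a strictly feasible comparison point inside `S` with value below `b`
  obtain ⟨p, hpN, hpcl⟩ := hcl
  obtain ⟨x₀, ⟨hx₀S, hx₀b⟩, hx₀⟩ := mem_closure_iff.1 hpcl (interior S ∩ {x | f x < b})
    (isOpen_interior.inter (isOpen_lt hf continuous_const))
    ⟨hNS hpN, (hsub hpN).2.2.trans_lt hb⟩
  obtain ⟨L, hL⟩ := hS.bddAbove_image (f := fun x => ∑ i, c x i)
    (continuous_finsetSum _ fun i _ => hci i).continuousOn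
  have hsmall : ∀ᶠ k in atTop, μ k * (L - ∑ i, Real.log (c x₀ i)) < b - f x₀ := by
    have h := hμ0.mul_const (L - ∑ i, Real.log (c x₀ i))
    rw [zero_mul] at h
    exact h.eventually_lt_const (sub_pos.2 hx₀b)
  obtain ⟨K, hK⟩ := eventually_atTop.1 hsmall
  refine ⟨K, fun k hk => ?_⟩
  obtain ⟨y, ⟨hyS, hy⟩, hymin⟩ := exists_isMinOn_log_barrier hf hc hS
    ⟨x₀, interior_subset hx₀S, hx₀⟩ (hμpos k)
  have hyint : y ∈ interior S := by
    by_contra hyn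
    have hby := hbf y ⟨⟨hyS, hyn⟩, fun i => (hy i).le⟩
    have hle := isMinOn_iff.1 hymin x₀ ⟨interior_subset hx₀S, hx₀⟩
    have hlogL : ∑ i, Real.log (c y i) ≤ L :=
      (Finset.sum_le_sum fun i _ => Real.log_le_self (hy i).le).trans
        (hL (mem_image_of_mem _ hyS))
    have hμL := mul_le_mul_of_nonneg_left hlogL (hμpos k).le
    have hKk := hK k hk
    rw [mul_sub] at hKk
    linarith
  refine ⟨y, ⟨hy, hyint⟩, fun x hx => hymin ⟨hx.2, hx.1⟩, hymin.isLocalMin ?_⟩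
  exact inter_mem (mem_interior_iff_mem_nhds.1 hyint) (hopen.mem_nhds hy)
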